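/- Let I ⊆ S be a squarefree monomial ideal with minimal primary decomposition I = I_{α_1} ∩ ⋯ ∩ I_{α_r} satisfying I_{α_1} + ⋯ + I_{α_r} = (x_1,…,x_n). Let e ≥ 0, q = p^e, suppose J_q ≠ 0, and let x^{γ_e} be any minimal monomial generator of J_q. Then x^{γ_e} ∉ L_e; that is, for every s ≥ 2 and all integers 1 ≤ β_1,…,β_s < e with β_1 + ⋯ + β_s = e, x^{γ_e} does not belong to the product K_{β_1}·K_{β_2}^{[p^{β_1}]}⋯K_{β_s}^{[p^{β_1+⋯+β_{s-1}}]}. -/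

import Mathlib

noncomputable section

/-- The `q`-th Frobenius power of an ideal: the ideal generated by `{f^q : f ∈ I}`. -/
def frobPow {R : Type*} [CommRing R] (q : ℕ) (I : Ideal R) : Ideal R :=
  Ideal.span ((fun f => f ^ q) '' (I : Set R))

/-- The monomial `x^γ = x_1^{γ_1} ⋯ x_n^{γ_n}` in `k[[x_1,…,x_n]]`. -/
def mon (k : Type*) [Field k] {n : ℕ} (γ : Fin n → ℕ) : MvPowerSeries (Fin n) k :=
  ∏ i, (MvPowerSeries.X i : MvPowerSeries (Fin n) k) ^ γ i

/-- The face ideal `I_α`, generated by the variables `x_i` with `α i = 1`. -/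
def faceIdeal (k : Type*) [Field k] {n : ℕ} (α : Fin n → ℕ) :
    Ideal (MvPowerSeries (Fin n) k) :=
  Ideal.span {f | ∃ i, α i = 1 ∧ f = MvPowerSeries.X i}

/-- `I = I_{α_1} ∩ ⋯ ∩ I_{α_r}` is the minimal primary decomposition of the squarefree
monomial ideal `I` into face ideals: each `α j` is a nonzero `{0,1}`-vector, `I` is the
intersection of the face ideals `I_{α j}`, and the decomposition is irredundant (the
supports of the `α j` are pairwise incomparable). -/
def IsMinFaceDecomp (k : Type*) [Field k] {n r : ℕ} (α : Fin r → Fin n → ℕ)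
    (I : Ideal (MvPowerSeries (Fin n) k)) : Prop :=
  (∀ j i, α j i = 0 ∨ α j i = 1) ∧ (∀ j, α j ≠ 0) ∧
    I = ⨅ j, faceIdeal k (α j) ∧
    ∀ j l, j ≠ l → ¬ ({i | α j i = 1} ⊆ {i | α l i = 1})

/-- `x^γ` is a minimal monomial generator of the monomial ideal `J`: `x^γ ∈ J` and no
monomial properly dividing `x^γ` belongs to `J`. -/
def IsMinGen (k : Type*) [Field k] {n : ℕ} (J : Ideal (MvPowerSeries (Fin n) k))
    (γ : Fin n → ℕ) : Prop :=
  mon k γ ∈ J ∧ ∀ δ : Fin n → ℕ, (∀ i, δ i ≤ γ i) → δ ≠ γ → mon k δ ∉ J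

/-- `J_q`: the unique minimal monomial ideal with
`(I^{[q]} :_S I) = I^{[q]} + J_q + ((x_1⋯x_n)^{q-1})`; equivalently, the ideal generated by
those minimal monomial generators of `(I^{[q]} :_S I)` lying neither in `I^{[q]}` nor in
the principal ideal `((x_1⋯x_n)^{q-1})`. -/
def Jideal (k : Type*) [Field k] {n : ℕ} (q : ℕ) (I : Ideal (MvPowerSeries (Fin n) k)) :
    Ideal (MvPowerSeries (Fin n) k) :=
  Ideal.span (mon k '' {γ | IsMinGen k ((frobPow q I).colon I) γ ∧
    mon k γ ∉ frobPow q I ∧ mon k γ ∉ Ideal.span {mon k (fun _ => 1) ^ (q - 1)}})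

/-- `L_e = Σ K_{β_1}·K_{β_2}^{[p^{β_1}]} ⋯ K_{β_s}^{[p^{β_1+⋯+β_{s-1}}]}`, the sum over all
`s ≥ 2` and all `1 ≤ β_1,…,β_s < e` with `β_1 + ⋯ + β_s = e`, where `K_a = (I^{[p^a]} :_S I)`. -/
def Lideal {R : Type*} [CommRing R] (p e : ℕ) (I : Ideal R) : Ideal R :=
  ⨆ (s : ℕ) (_ : 2 ≤ s) (β : Fin s → ℕ)
    (_ : (∀ i, 1 ≤ β i ∧ β i < e) ∧ ∑ i, β i = e),
    ∏ i, frobPow (p ^ (∑ j ∈ Finset.Iio i, β j)) ((frobPow (p ^ β i) I).colon I)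

/-- The ideal of power series all of whose monomials have exponents in the upper set `U`. -/
def suppIdeal (k : Type*) [Field k] {n : ℕ} (U : UpperSet (Fin n → ℕ)) :
    Ideal (MvPowerSeries (Fin n) k) where
  carrier := {f | ∀ d : Fin n →₀ ℕ, MvPowerSeries.coeff d f ≠ 0 → (⇑d : Fin n → ℕ) ∈ U}
  zero_mem' := by simp
  add_mem' := by
    intro f g hf hg d hd
    by_cases h : MvPowerSeries.coeff d f = 0
    · exact hg d (by simpa [h] using hd)
    · exact hf d h
  smul_mem' := by
    intro c f hf d hd
    rw [smul_eq_mul, MvPowerSeries.coeff_mul] at hd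
    obtain ⟨x, hx, hx0⟩ := Finset.exists_ne_zero_of_sum_ne_zero hd
    rw [Finset.HasAntidiagonal.mem_antidiagonal] at hx
    refine U.upper (?_ : (⇑x.2 : Fin n → ℕ) ≤ d) (hf x.2 (right_ne_zero_of_mul hx0))
    rw [← hx]
    exact fun i => by simp

section suppIdeal

variable {k : Type*} [Field k] {n : ℕ}

theorem mem_suppIdeal {U : UpperSet (Fin n → ℕ)} {f : MvPowerSeries (Fin n) k} :
    f ∈ suppIdeal k U ↔
      ∀ d : Fin n →₀ ℕ, MvPowerSeries.coeff d f ≠ 0 → (⇑d : Fin n → ℕ) ∈ U :=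
  Iff.rfl

theorem mon_eq_monomial (γ : Fin n → ℕ) :
    mon k γ = MvPowerSeries.monomial (Finsupp.equivFunOnFinite.symm γ) 1 := by
  classical
  have h : ∀ s : Finset (Fin n), ∏ i ∈ s, (MvPowerSeries.X i : MvPowerSeries (Fin n) k) ^ γ i =
      MvPowerSeries.monomial (∑ i ∈ s, Finsupp.single i (γ i)) 1 := by
    intro s
    induction s using Finset.induction_on with
    | empty => simp
    | insert a s ha ih =>
      rw [Finset.prod_insert ha, Finset.sum_insert ha, ih, MvPowerSeries.X_pow_eq,
        MvPowerSeries.monomial_mul_monomial, one_mul]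
  rw [mon, h]
  congr 2
  ext i
  simp [Finsupp.finsetSum_apply, Finsupp.single_apply]

theorem mon_mem_suppIdeal {U : UpperSet (Fin n → ℕ)} {γ : Fin n → ℕ} :
    mon k γ ∈ suppIdeal k U ↔ γ ∈ U := by
  classical
  rw [mem_suppIdeal, mon_eq_monomial]
  constructor
  · intro h
    simpa using h (Finsupp.equivFunOnFinite.symm γ) (by simp)
  · intro h d hd
    rw [MvPowerSeries.coeff_monomial] at hd
    have : d = Finsupp.equivFunOnFinite.symm γ := by
      by_contra hne
      simp [hne] at hd
    simpa [this] using h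

theorem X_eq_mon (i : Fin n) :
    (MvPowerSeries.X i : MvPowerSeries (Fin n) k) = mon k (Pi.single i 1) := by
  classical
  rw [mon, Finset.prod_eq_single i]
  · simp
  · intro j _ hj
    simp [hj]
  · simp

theorem mon_mul_mon (γ δ : Fin n → ℕ) : mon k γ * mon k δ = mon k (γ + δ) := by
  simp [mon, pow_add, Finset.prod_mul_distrib]

theorem mon_pow (γ : Fin n → ℕ) (q : ℕ) : mon k γ ^ q = mon k (q • γ) := by
  simp [mon, ← Finset.prod_pow, ← pow_mul, mul_comm]

theorem mon_dvd_mon {γ δ : Fin n → ℕ} (h : γ ≤ δ) : mon k γ ∣ mon k δ :=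
  ⟨mon k (δ - γ), by rw [mon_mul_mon, add_tsub_cancel_of_le h]⟩

theorem suppIdeal_mul_le {U V W : UpperSet (Fin n → ℕ)}
    (h : ∀ a ∈ U, ∀ b ∈ V, a + b ∈ W) : suppIdeal k U * suppIdeal k V ≤ suppIdeal k W := by
  classical
  rw [Ideal.mul_le]
  intro f hf g hg d hd
  rw [MvPowerSeries.coeff_mul] at hd
  obtain ⟨x, hx, hx0⟩ := Finset.exists_ne_zero_of_sum_ne_zero hd
  rw [Finset.HasAntidiagonal.mem_antidiagonal] at hx
  rw [← hx, Finsupp.coe_add]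
  exact h _ (hf _ (left_ne_zero_of_mul hx0)) _ (hg _ (right_ne_zero_of_mul hx0))

theorem frobPow_le_suppIdeal {p : ℕ} [Fact p.Prime] [CharP k p] {a : ℕ}
    {I : Ideal (MvPowerSeries (Fin n) k)} {U V : UpperSet (Fin n → ℕ)}
    (hI : I ≤ suppIdeal k U) (h : ∀ d ∈ U, p ^ a • d ∈ V) :
    frobPow (p ^ a) I ≤ suppIdeal k V := by
  classical
  have hp : p ≠ 0 := (Fact.out : p.Prime).ne_zero
  have : ExpChar k p := ExpChar.prime Fact.out
  rw [frobPow, Ideal.span_le]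
  rintro _ ⟨f, hf, rfl⟩ d hd
  dsimp only at hd
  rw [← MvPowerSeries.map_iterateFrobenius_expand p hp, MvPowerSeries.coeff_map] at hd
  have hd' : MvPowerSeries.coeff d (MvPowerSeries.expand (p ^ a) (pow_ne_zero a hp) f) ≠ 0 :=
    fun h0 => hd (by rw [h0, map_zero])
  have := MvPowerSeries.support_expand_subset (p ^ a) (pow_ne_zero a hp) f hd'
  obtain ⟨c, hc, rfl⟩ := this
  exact h _ (hI hf c hc)

theorem le_span_mon_of_finite {U : UpperSet (Fin n → ℕ)} {A : Set (Fin n → ℕ)} (hA : A.Finite)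
    (hU : ∀ d ∈ U, ∃ a ∈ A, a ≤ d) : suppIdeal k U ≤ Ideal.span (mon k '' A) := by
  classical
  intro f hf
  have hc : ∀ d : Fin n → ℕ, ∃ a, d ∈ U → a ∈ A ∧ a ≤ d := by
    intro d
    by_cases hd : d ∈ U
    · obtain ⟨a, ha, had⟩ := hU d hd
      exact ⟨a, fun _ => ⟨ha, had⟩⟩
    · exact ⟨0, fun h => absurd h hd⟩
  choose c hc using hc
  let E := (Finsupp.equivFunOnFinite (α := Fin n) (M := ℕ)).symm
  let g : (Fin n → ℕ) → MvPowerSeries (Fin n) k := fun a b =>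
    if c (⇑(E a + b)) = a then MvPowerSeries.coeff (E a + b) f else 0
  have hfg : f = ∑ a ∈ hA.toFinset, mon k a * g a := by
    ext d
    rw [map_sum]
    have hterm : ∀ a, MvPowerSeries.coeff d (mon k a * g a) =
        if a ≤ ⇑d ∧ c ⇑d = a then MvPowerSeries.coeff d f else 0 := by
      intro a
      rw [mon_eq_monomial, MvPowerSeries.coeff_monomial_mul, one_mul]
      have hle : E a ≤ d ↔ a ≤ ⇑d := Iff.rfl
      by_cases hd : a ≤ ⇑d
      · have hd' := hle.2 hd
        have : E a + (d - E a) = d := add_tsub_cancel_of_le hd'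
        rw [if_pos hd']
        change (if c (⇑(E a + (d - E a))) = a then
          MvPowerSeries.coeff (E a + (d - E a)) f else 0) = _
        rw [this]
        simp [hd]
      · rw [if_neg (fun h => hd (hle.1 h)), if_neg (fun h => hd h.1)]
    rw [Finset.sum_congr rfl fun a _ => hterm a]
    by_cases hd : MvPowerSeries.coeff d f = 0
    · simp [hd]
    · obtain ⟨h1, h2⟩ := hc _ (hf d hd)
      rw [Finset.sum_eq_single (c ⇑d)]
      · rw [if_pos ⟨h2, rfl⟩]
      · intro b _ hb
        rw [if_neg (fun h => hb h.2.symm)]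
      · intro h
        exact absurd (hA.mem_toFinset.2 h1) h
  rw [hfg]
  refine Ideal.sum_mem _ fun a ha => Ideal.mul_mem_right _ _ (Ideal.subset_span ?_)
  exact ⟨a, hA.mem_toFinset.1 ha, rfl⟩

end suppIdeal

section exponents

variable {n r : ℕ}

/-- Exponents having an entry at least `q` in the support of `β`. -/
def faceExponents (β : Fin n → ℕ) (q : ℕ) : UpperSet (Fin n → ℕ) where
  carrier := {d | ∃ i, β i = 1 ∧ q ≤ d i}
  upper' := fun _ _ hab ⟨i, hi, hq⟩ => ⟨i, hi, hq.trans (hab i)⟩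

/-- Exponents of the monomials lying in `(I^{[q]} : I)`, where `I` is the intersection of the
face ideals `I_{α_j}`. -/
def colonExponents (α : Fin r → Fin n → ℕ) (q : ℕ) : UpperSet (Fin n → ℕ) where
  carrier := {d | ∀ j, d ∈ faceExponents (α j) q ∨ ∀ i, α j i = 1 → q - 1 ≤ d i}
  upper' := fun _ _ hab ha j => (ha j).imp ((faceExponents (α j) q).upper hab)
    fun h i hi => (h i hi).trans (hab i)

theorem mem_faceExponents {β : Fin n → ℕ} {q : ℕ} {d : Fin n → ℕ} :
    d ∈ faceExponents β q ↔ ∃ i, β i = 1 ∧ q ≤ d i :=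
  Iff.rfl

theorem mem_colonExponents {α : Fin r → Fin n → ℕ} {q : ℕ} {d : Fin n → ℕ} :
    d ∈ colonExponents α q ↔
      ∀ j, (∃ i, α j i = 1 ∧ q ≤ d i) ∨ ∀ i, α j i = 1 → q - 1 ≤ d i :=
  Iff.rfl

theorem add_smul_mem_colonExponents {α : Fin r → Fin n → ℕ} {q q' : ℕ} (hq : 0 < q) (hq' : 0 < q')
    {d d' : Fin n → ℕ} (hd : d ∈ colonExponents α q) (hd' : d' ∈ colonExponents α q') :
    d + q • d' ∈ colonExponents α (q * q') := by
  rw [mem_colonExponents] at *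
  intro j
  rcases hd' j with ⟨i, hi, hle⟩ | h'
  · left
    refine ⟨i, hi, ?_⟩
    have := Nat.mul_le_mul_left q hle
    simp only [Pi.add_apply, Pi.smul_apply, smul_eq_mul]
    omega
  · obtain ⟨t, rfl⟩ : ∃ t, q' = t + 1 := ⟨q' - 1, by omega⟩
    have key : ∀ i, α j i = 1 → q * t ≤ q * d' i := fun i hi =>
      Nat.mul_le_mul_left q (by simpa using h' i hi)
    simp only [Pi.add_apply, Pi.smul_apply, smul_eq_mul, mul_add, mul_one]
    rcases hd j with ⟨i, hi, hle⟩ | h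
    · left
      refine ⟨i, hi, ?_⟩
      have := key i hi
      omega
    · right
      intro i hi
      have := key i hi
      have := h i hi
      omega

theorem eq_zero_of_minimal_of_lt {α : Fin r → Fin n → ℕ} {q : ℕ} {γ : Fin n → ℕ}
    (hγ : Minimal (· ∈ colonExponents α q) γ) {i : Fin n} (hi : γ i < q - 1) : γ i = 0 := by
  classical
  by_contra h0
  have hle : Function.update γ i 0 ≤ γ := by
    rw [update_le_iff]
    exact ⟨Nat.zero_le _, fun _ _ => le_rfl⟩
  have hmem : Function.update γ i 0 ∈ colonExponents α q := by
    have hγ' := mem_colonExponents.1 hγ.prop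
    rw [mem_colonExponents]
    intro j
    rcases hγ' j with ⟨i', hi', h'⟩ | h'
    · refine Or.inl ⟨i', hi', ?_⟩
      rw [Function.update_of_ne]
      · exact h'
      · rintro rfl
        omega
    · refine Or.inr fun i' hi' => ?_
      rw [Function.update_of_ne]
      · exact h' i' hi'
      · rintro rfl
        have := h' i' hi'
        omega
  have := hγ.le_of_le hmem hle i
  simp at this
  omega

/-- A minimal exponent with an entry at least `q` has a face on which this is the only
entry exceeding `q - 1`, and on which some entry vanishes. -/
theorem exists_face_of_minimal {α : Fin r → Fin n → ℕ} {q : ℕ} (hq : 2 ≤ q) {γ : Fin n → ℕ}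
    (hγ : Minimal (· ∈ colonExponents α q) γ) {i : Fin n} (hi : q ≤ γ i) :
    γ i = q ∧ ∃ l, (∃ m, α l m = 1 ∧ γ m = 0) ∧ ∀ m, α l m = 1 → q ≤ γ m → m = i := by
  classical
  have hle : Function.update γ i (γ i - 1) ≤ γ := by
    rw [update_le_iff]
    exact ⟨Nat.sub_le _ _, fun _ _ => le_rfl⟩
  have hnot : Function.update γ i (γ i - 1) ∉ colonExponents α q := by
    intro hmem
    have := hγ.le_of_le hmem hle i
    simp at this
    omega
  rw [mem_colonExponents] at hnot
  push Not at hnot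
  obtain ⟨l, h1, m, hm, h2⟩ := hnot
  have huniq : ∀ m, α l m = 1 → q ≤ γ m → m = i := by
    intro m hm hqm
    by_contra hne
    have := h1 m hm
    rw [Function.update_of_ne hne] at this
    omega
  have hmi : m ≠ i := by
    rintro rfl
    rw [Function.update_self] at h2
    omega
  rw [Function.update_of_ne hmi] at h2
  have hli : α l i = 1 := by
    rcases mem_colonExponents.1 hγ.prop l with ⟨i', hi', h'⟩ | h'
    · rwa [← huniq i' hi' h']
    · have := h' m hm
      omega
  have := h1 i hli
  rw [Function.update_self] at this
  exact ⟨by omega, l, ⟨m, hm, eq_zero_of_minimal_of_lt hγ h2⟩, huniq⟩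

theorem not_add_smul_le_of_minimal {α : Fin r → Fin n → ℕ} {p : ℕ} (hp : 2 ≤ p) {a b : ℕ}
    (ha : 1 ≤ a) (hb : 1 ≤ b) (hcov : ∀ i, ∃ j, α j i = 1) {γ : Fin n → ℕ}
    (hγ : Minimal (· ∈ colonExponents α (p ^ (a + b))) γ) (hlt : ∃ i, γ i < p ^ (a + b) - 1)
    {d d' : Fin n → ℕ} (hd : d ∈ colonExponents α (p ^ a)) (hd' : d' ∈ colonExponents α (p ^ b)) :
    ¬ d + p ^ a • d' ≤ γ := by
  intro hle
  have hpa : 2 ≤ p ^ a := hp.trans (Nat.le_self_pow (by omega) p)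
  have hpb : 2 ≤ p ^ b := hp.trans (Nat.le_self_pow (by omega) p)
  have hpab : 2 ≤ p ^ (a + b) := hp.trans (Nat.le_self_pow (by omega) p)
  obtain ⟨i₀, hi₀⟩ := hlt
  obtain ⟨j₀, hj₀⟩ := hcov i₀
  obtain ⟨i, hi, hqi⟩ : ∃ i, α j₀ i = 1 ∧ p ^ (a + b) ≤ γ i := by
    rcases mem_colonExponents.1 hγ.prop j₀ with h | h
    · exact h
    · have := h i₀ hj₀
      omega
  obtain ⟨hγi, l, ⟨m, hm, hγm⟩, huniq⟩ := exists_face_of_minimal hpab hγ hqi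
  set c : Fin n → ℕ := fun i => min (d i) (p ^ a) with hc
  have hcmem : c ∈ colonExponents α (p ^ a) := by
    rw [mem_colonExponents] at *
    intro j
    refine (hd j).imp ?_ ?_
    · rintro ⟨i, hi, h⟩
      exact ⟨i, hi, le_min h le_rfl⟩
    · intro h i hi
      exact le_min (h i hi) (Nat.sub_le _ _)
  have hsum : c + p ^ a • d' = γ := by
    have hle' : c + p ^ a • d' ≤ γ := le_trans (by gcongr; exact fun i => min_le_left _ _) hle
    refine le_antisymm hle' (hγ.le_of_le ?_ hle')
    rw [pow_add]
    exact add_smul_mem_colonExponents (by omega) (by omega) hcmem hd'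
  have hval : ∀ t, c t + p ^ a * d' t = γ t := fun t => congrFun hsum t
  have hvm := hval m
  have hcm : c m = 0 := by omega
  have hdm : d' m = 0 := by
    have : p ^ a * d' m = 0 := by omega
    rcases Nat.mul_eq_zero.1 this with h | h
    · omega
    · exact h
  obtain ⟨u, hu, hcu⟩ : ∃ u, α l u = 1 ∧ p ^ a ≤ c u := by
    rcases mem_colonExponents.1 hcmem l with h | h
    · exact h
    · have := h m hm
      omega
  obtain ⟨v, hv, hdv⟩ : ∃ v, α l v = 1 ∧ p ^ b ≤ d' v := by
    rcases mem_colonExponents.1 hd' l with h | h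
    · exact h
    · have := h m hm
      omega
  have hmul : p ^ (a + b) ≤ p ^ a * d' v := by
    rw [pow_add]
    exact Nat.mul_le_mul_left _ hdv
  have hvv := hval v
  obtain rfl : v = i := huniq v hv (by omega)
  have hui : u ≠ v := by
    rintro rfl
    omega
  have hvu := hval u
  have hγu : γ u < p ^ (a + b) := by
    by_contra h
    exact hui (huniq u hu (by omega))
  rcases Nat.lt_or_ge (γ u) (p ^ (a + b) - 1) with h | h
  · have := eq_zero_of_minimal_of_lt hγ h
    omega
  · have hcu' : c u = p ^ a := le_antisymm (min_le_right _ _) hcu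
    have h1 : p ^ a ∣ γ u := ⟨1 + d' u, by rw [← hvu, hcu']; ring⟩
    have h2 : p ^ a ∣ p ^ (a + b) := pow_dvd_pow p (Nat.le_add_right a b)
    have h3 : p ^ a ∣ p ^ (a + b) - γ u := Nat.dvd_sub h2 h1
    have := Nat.le_of_dvd (by omega) h3
    omega

end exponents

section colon

variable {k : Type*} [Field k] {n r : ℕ}

theorem faceIdeal_eq_suppIdeal (β : Fin n → ℕ) :
    faceIdeal k β = suppIdeal k (faceExponents β 1) := by
  classical
  apply le_antisymm
  · rw [faceIdeal, Ideal.span_le]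
    rintro _ ⟨i, hi, rfl⟩
    rw [SetLike.mem_coe, X_eq_mon, mon_mem_suppIdeal]
    exact ⟨i, hi, by simp⟩
  · refine (le_span_mon_of_finite (A := (fun i => Pi.single i 1) '' {i | β i = 1})
      (Set.toFinite _) ?_).trans ?_
    · rintro d ⟨i, hi, hd⟩
      refine ⟨_, ⟨i, hi, rfl⟩, ?_⟩
      exact update_le_iff.2 ⟨hd, fun _ _ => Nat.zero_le _⟩
    · refine Ideal.span_mono ?_
      rintro _ ⟨_, ⟨i, hi, rfl⟩, rfl⟩
      exact ⟨i, hi, (X_eq_mon i).symm⟩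

theorem mon_mem_iInf_faceIdeal {α : Fin r → Fin n → ℕ} {d : Fin n → ℕ} :
    mon k d ∈ ⨅ j, faceIdeal k (α j) ↔ ∀ j, d ∈ faceExponents (α j) 1 := by
  simp only [Ideal.mem_iInf, faceIdeal_eq_suppIdeal, mon_mem_suppIdeal]

theorem iInf_faceIdeal_le_span (α : Fin r → Fin n → ℕ) :
    (⨅ j, faceIdeal k (α j)) ≤ Ideal.span (mon k '' {d | ∀ j, d ∈ faceExponents (α j) 1}) := by
  let U : UpperSet (Fin n → ℕ) := ⟨{d | ∀ j, d ∈ faceExponents (α j) 1},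
    fun a b hab ha j => (faceExponents (α j) 1).upper hab (ha j)⟩
  have hle : (⨅ j, faceIdeal k (α j)) ≤ suppIdeal k U := by
    intro f hf d hd j
    rw [Ideal.mem_iInf] at hf
    have := hf j
    rw [faceIdeal_eq_suppIdeal] at this
    exact this d hd
  have hfin : {d : Fin n → ℕ | (∀ i, d i ≤ 1) ∧ d ∈ U}.Finite :=
    (Set.finite_Iic (fun _ => 1 : Fin n → ℕ)).subset fun d hd => hd.1
  refine hle.trans ((le_span_mon_of_finite hfin fun d hd => ?_).trans ?_)
  · refine ⟨fun i => min (d i) 1, ⟨fun i => min_le_right _ _, fun j => ?_⟩,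
      fun i => min_le_left _ _⟩
    obtain ⟨i, hi, hdi⟩ := hd j
    exact ⟨i, hi, le_min hdi le_rfl⟩
  · exact Ideal.span_mono (Set.image_mono fun d hd => hd.2)

theorem frobPow_le_suppIdeal_faceExponents {p : ℕ} [Fact p.Prime] [CharP k p]
    (α : Fin r → Fin n → ℕ) (a : ℕ) (j : Fin r) :
    frobPow (p ^ a) (⨅ j, faceIdeal k (α j)) ≤ suppIdeal k (faceExponents (α j) (p ^ a)) := by
  refine frobPow_le_suppIdeal (U := faceExponents (α j) 1) ?_ ?_
  · exact (iInf_le _ j).trans (faceIdeal_eq_suppIdeal _).le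
  · rintro d ⟨i, hi, hd⟩
    exact ⟨i, hi, by simpa using Nat.mul_le_mul_left (p ^ a) hd⟩

theorem colon_le_suppIdeal {p : ℕ} [Fact p.Prime] [CharP k p] {α : Fin r → Fin n → ℕ}
    (hinc : ∀ j l, j ≠ l → ¬ ({i | α j i = 1} ⊆ {i | α l i = 1})) (a : ℕ) :
    (frobPow (p ^ a) (⨅ j, faceIdeal k (α j))).colon
      ((⨅ j, faceIdeal k (α j) : Ideal (MvPowerSeries (Fin n) k)) : Set _) ≤
      suppIdeal k (colonExponents α (p ^ a)) := by
  classical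
  intro f hf d hd j
  by_contra hcon
  rw [not_or, mem_faceExponents] at hcon
  push Not at hcon
  obtain ⟨h1, i₀, hi₀, h2⟩ := hcon
  let u : Fin n → ℕ := fun i => if i = i₀ ∨ α j i ≠ 1 then 1 else 0
  have hu : mon k u ∈ ⨅ j, faceIdeal k (α j) := by
    rw [mon_mem_iInf_faceIdeal]
    intro l
    by_cases hl : l = j
    · exact ⟨i₀, hl ▸ hi₀, by simp [u]⟩
    · obtain ⟨i, hi, hij⟩ := Set.not_subset.1 (hinc l j hl)
      have hij' : α j i ≠ 1 := hij
      exact ⟨i, hi, by simp [u, hij']⟩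
  have hmul : f * mon k u ∈ frobPow (p ^ a) (⨅ j, faceIdeal k (α j)) :=
    Submodule.mem_colon.1 hf _ hu
  have := frobPow_le_suppIdeal_faceExponents α a j hmul (d + Finsupp.equivFunOnFinite.symm u)
  rw [mon_eq_monomial, MvPowerSeries.coeff_add_mul_monomial, mul_one] at this
  obtain ⟨i, hi, hle⟩ := this hd
  have hd1 := h1 i hi
  simp only [Finsupp.coe_add, Pi.add_apply, Finsupp.coe_equivFunOnFinite_symm, u] at hle
  by_cases hii : i = i₀
  · subst hii
    simp at hle
    omega
  · simp [hii, hi] at hle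
    omega

theorem mon_mem_colon {q : ℕ} (hq : 0 < q) {α : Fin r → Fin n → ℕ} {d : Fin n → ℕ}
    (hd : d ∈ colonExponents α q) :
    mon k d ∈ (frobPow q (⨅ j, faceIdeal k (α j))).colon
      ((⨅ j, faceIdeal k (α j) : Ideal (MvPowerSeries (Fin n) k)) : Set _) := by
  classical
  have hle : (⨅ j, faceIdeal k (α j)) ≤
      (frobPow q (⨅ j, faceIdeal k (α j))).colon {mon k d} := by
    refine (iInf_faceIdeal_le_span α).trans (Ideal.span_le.2 ?_)
    rintro _ ⟨u, hu, rfl⟩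
    rw [SetLike.mem_coe, Submodule.mem_colon_singleton, smul_eq_mul, mon_mul_mon]
    let v : Fin n → ℕ := fun i => if q ≤ u i + d i then 1 else 0
    have hv : mon k v ∈ ⨅ j, faceIdeal k (α j) := by
      rw [mon_mem_iInf_faceIdeal]
      intro j
      obtain ⟨i, hi, hqi⟩ : ∃ i, α j i = 1 ∧ q ≤ u i + d i := by
        rcases hd j with ⟨i, hi, h⟩ | h
        · exact ⟨i, hi, by omega⟩
        · obtain ⟨i, hi, h'⟩ := hu j
          have := h i hi
          exact ⟨i, hi, by omega⟩
      exact ⟨i, hi, by simp [v, hqi]⟩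
    refine Ideal.mem_of_dvd _ (mon_dvd_mon (γ := q • v) fun i => ?_)
      (mon_pow (k := k) v q ▸ Ideal.subset_span ⟨_, hv, rfl⟩)
    by_cases h : q ≤ u i + d i <;> simp [v, h]
  rw [Submodule.mem_colon]
  intro s hs
  have := Submodule.mem_colon_singleton.1 (hle hs)
  rwa [smul_eq_mul, mul_comm] at this

end colon

section products

variable {k : Type*} [Field k] {n r : ℕ}

/-- Exponents dominating `q • c` for some exponent `c` in `U`. -/
def scaledExponents (q : ℕ) (U : UpperSet (Fin n → ℕ)) : UpperSet (Fin n → ℕ) where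
  carrier := {d | ∃ c ∈ U, q • c ≤ d}
  upper' := fun _ _ hab ⟨c, hc, hle⟩ => ⟨c, hc, hle.trans hab⟩

theorem sum_Iio_fin_succ {s : ℕ} (β : Fin (s + 1) → ℕ) (i : Fin s) :
    ∑ j ∈ Finset.Iio i.succ, β j = β 0 + ∑ j ∈ Finset.Iio i, β j.succ := by
  have h : ∀ {m : ℕ} (f : Fin m → ℕ) (i : Fin m),
      ∑ j ∈ Finset.Iio i, f j = ∑ j, if j < i then f j else 0 := by
    intro m f i
    rw [← Finset.sum_filter]
    congr 1
    ext j
    simp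
  rw [h, h, Fin.sum_univ_succ]
  simp [Fin.succ_lt_succ_iff]

theorem prod_frobPow_colon_le {p : ℕ} [Fact p.Prime] [CharP k p] {α : Fin r → Fin n → ℕ}
    {I : Ideal (MvPowerSeries (Fin n) k)} (hI : ∀ a, (frobPow (p ^ a) I).colon I ≤
      suppIdeal k (colonExponents α (p ^ a))) (s : ℕ) (β : Fin s → ℕ) (a : ℕ) :
    ∏ i, frobPow (p ^ (a + ∑ j ∈ Finset.Iio i, β j)) ((frobPow (p ^ β i) I).colon I) ≤
      suppIdeal k (scaledExponents (p ^ a) (colonExponents α (p ^ ∑ i, β i))) := by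
  have hp : 0 < p := (Fact.out : p.Prime).pos
  induction s generalizing a with
  | zero =>
    intro f _ d _
    exact ⟨0, fun j => Or.inr fun i _ => by simp, by simp⟩
  | succ s ih =>
    rw [Fin.prod_univ_succ, Fin.sum_univ_succ]
    simp only [sum_Iio_fin_succ, ← add_assoc]
    refine (Ideal.mul_mono (frobPow_le_suppIdeal (hI _) (V := scaledExponents (p ^ a)
      (colonExponents α (p ^ β 0))) ?_) (ih (fun i => β i.succ) (a + β 0))).trans
      (suppIdeal_mul_le ?_)
    · intro d hd
      have h0 : Finset.Iio (0 : Fin (s + 1)) = ∅ := by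
        ext x
        simp
      rw [h0, Finset.sum_empty, add_zero]
      exact ⟨d, hd, le_rfl⟩
    · rintro d ⟨c, hc, hle⟩ d' ⟨c', hc', hle'⟩
      refine ⟨c + p ^ β 0 • c', ?_, ?_⟩
      · rw [pow_add]
        exact add_smul_mem_colonExponents (pow_pos hp _) (pow_pos hp _) hc hc'
      · rw [smul_add, smul_smul, ← pow_add]
        exact add_le_add hle hle'

/-- Exponents dominating `c + p ^ a • c'`, with `c` and `c'` exponents of monomials in `K_a`
and `K_b`, for some `a, b ≥ 1` with `a + b = e`. -/
def decomposableExponents (α : Fin r → Fin n → ℕ) (p e : ℕ) : UpperSet (Fin n → ℕ) where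
  carrier := {d | ∃ a b, 1 ≤ a ∧ 1 ≤ b ∧ a + b = e ∧ ∃ c ∈ colonExponents α (p ^ a),
    ∃ c' ∈ colonExponents α (p ^ b), c + p ^ a • c' ≤ d}
  upper' := fun _ _ hab ⟨a, b, ha, hb, he, c, hc, c', hc', hle⟩ =>
    ⟨a, b, ha, hb, he, c, hc, c', hc', hle.trans hab⟩

theorem Lideal_le_suppIdeal {p : ℕ} [Fact p.Prime] [CharP k p] {α : Fin r → Fin n → ℕ}
    {I : Ideal (MvPowerSeries (Fin n) k)} (hI : ∀ a, (frobPow (p ^ a) I).colon I ≤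
      suppIdeal k (colonExponents α (p ^ a))) (e : ℕ) :
    Lideal p e I ≤ suppIdeal k (decomposableExponents α p e) := by
  refine iSup_le fun s => iSup_le fun hs => iSup_le fun β => iSup_le fun hβ => ?_
  obtain ⟨t, rfl⟩ : ∃ t, s = t + 2 := ⟨s - 2, by omega⟩
  obtain ⟨hβ, he⟩ := hβ
  have htail := prod_frobPow_colon_le hI (t + 1) (fun i => β i.succ) (β 0)
  have hhead : frobPow (p ^ ∑ j ∈ Finset.Iio (0 : Fin (t + 2)), β j)
      ((frobPow (p ^ β 0) I).colon I) ≤ suppIdeal k (colonExponents α (p ^ β 0)) := by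
    have h0 : Finset.Iio (0 : Fin (t + 2)) = ∅ := by
      ext x
      simp
    rw [h0, Finset.sum_empty]
    exact frobPow_le_suppIdeal (hI _) fun d hd => by simpa using hd
  rw [Fin.sum_univ_succ] at he
  rw [Fin.prod_univ_succ]
  simp only [sum_Iio_fin_succ]
  refine (Ideal.mul_mono hhead htail).trans (suppIdeal_mul_le ?_)
  rintro d hd d' ⟨c, hc, hle⟩
  refine ⟨β 0, ∑ i : Fin (t + 1), β i.succ, (hβ 0).1, ?_, he, d, hd, c, hc, ?_⟩
  · exact (hβ _).1.trans (Finset.single_le_sum (f := fun i : Fin (t + 1) => β i.succ)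
      (fun _ _ => Nat.zero_le _) (Finset.mem_univ 0))
  · gcongr

theorem isMinGen_colon_of_isMinGen_Jideal {q : ℕ} {I : Ideal (MvPowerSeries (Fin n) k)}
    {γ : Fin n → ℕ} (hγ : IsMinGen k (Jideal k q I) γ) :
    IsMinGen k ((frobPow q I).colon I) γ ∧
      mon k γ ∉ Ideal.span {mon k (fun _ => 1) ^ (q - 1)} := by
  set T : Set (Fin n → ℕ) := {γ | IsMinGen k ((frobPow q I).colon I) γ ∧
    mon k γ ∉ frobPow q I ∧ mon k γ ∉ Ideal.span {mon k (fun _ => 1) ^ (q - 1)}} with hT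
  have hle : Jideal k q I ≤ suppIdeal k (upperClosure T) := by
    rw [Jideal, Ideal.span_le]
    rintro _ ⟨d, hd, rfl⟩
    rw [SetLike.mem_coe, mon_mem_suppIdeal]
    exact subset_upperClosure hd
  obtain ⟨d, hd, hdγ⟩ := mem_upperClosure.1 (mon_mem_suppIdeal.1 (hle hγ.1))
  have hdeq : d = γ := by
    by_contra hne
    exact hγ.2 d hdγ hne (Ideal.subset_span ⟨d, hd, rfl⟩)
  subst hdeq
  exact ⟨hd.1, hd.2.2⟩

end products

theorem statement9 (p : ℕ) [Fact p.Prime] (k : Type*) [Field k] [CharP k p]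
    (n : ℕ) (hn : 0 < n) (r : ℕ) (hr : 0 < r) (α : Fin r → Fin n → ℕ)
    (I : Ideal (MvPowerSeries (Fin n) k)) (hdec : IsMinFaceDecomp k α I)
    (hsum : (⨆ j, faceIdeal k (α j)) =
      Ideal.span (Set.range (MvPowerSeries.X : Fin n → MvPowerSeries (Fin n) k)))
    (e : ℕ) (hJ : Jideal k (p ^ e) I ≠ ⊥) (γ : Fin n → ℕ)
    (hγ : IsMinGen k (Jideal k (p ^ e) I) γ) :
    mon k γ ∉ Lideal p e I := by
  obtain ⟨-, -, rfl, hinc⟩ := hdec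
  have hI := fun a => colon_le_suppIdeal (k := k) (p := p) hinc a
  have hp : p.Prime := Fact.out
  obtain ⟨hmin, hnot⟩ := isMinGen_colon_of_isMinGen_Jideal hγ
  have hminimal : Minimal (· ∈ colonExponents α (p ^ e)) γ := by
    refine ⟨mon_mem_suppIdeal.1 (hI e hmin.1), fun d hd hle => ?_⟩
    by_contra hne
    exact hmin.2 d hle (fun h => hne h.ge) (mon_mem_colon (pow_pos hp.pos e) hd)
  have hlt : ∃ i, γ i < p ^ e - 1 := by
    by_contra! hge
    refine hnot (Ideal.mem_span_singleton.2 ?_)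
    rw [mon_pow]
    exact mon_dvd_mon fun i => by simpa using hge i
  have hcov : ∀ i, ∃ j, α j i = 1 := by
    intro i
    let U : UpperSet (Fin n → ℕ) := ⟨{d | ∃ j, d ∈ faceExponents (α j) 1},
      fun a b hab ⟨j, hj⟩ => ⟨j, (faceExponents (α j) 1).upper hab hj⟩⟩
    have hle : (⨆ j, faceIdeal k (α j)) ≤ suppIdeal k U := by
      refine iSup_le fun j => (faceIdeal_eq_suppIdeal (α j)).le.trans ?_
      exact fun f hf d hd => ⟨j, hf d hd⟩
    have hX := hle (hsum.ge (Ideal.subset_span ⟨i, rfl⟩))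
    rw [X_eq_mon, mon_mem_suppIdeal] at hX
    obtain ⟨j, i', hi', h1⟩ := hX
    obtain rfl : i' = i := by
      by_contra hne
      simp [hne] at h1
    exact ⟨j, hi'⟩
  intro hL
  obtain ⟨a, b, ha, hb, rfl, c, hc, c', hc', hle⟩ :=
    mon_mem_suppIdeal.1 (Lideal_le_suppIdeal hI e hL)
  exact not_add_smul_le_of_minimal hp.two_le ha hb hcov hminimal hlt hc hc' hle

end
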